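/- Let A be a ℤ-graded left-artinian ring. Forgetting the grading induces a bijection between isomorphism classes of indecomposable projective ℤ-graded A-modules modulo shift of grading and isomorphism classes of indecomposable projective ungraded A-modules. -/

import Mathlib

universe u

/-- A bundled `ℤ`-graded module over a `ℤ`-graded ring `(A, 𝒜)`. -/
structure GradedModuleOver (A : Type u) [Ring A] (𝒜 : ℤ → AddSubgroup A) :
    Type (u + 1) where
  carrier : Type u
  [isAddCommGroup : AddCommGroup carrier]
  [isModule : Module A carrier]
  grading : ℤ → AddSubgroup carrier
  [isDecomposition : DirectSum.Decomposition grading]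
  smul_mem : ∀ ⦃i j : ℤ⦄ ⦃a : A⦄ ⦃m : carrier⦄,
    a ∈ 𝒜 i → m ∈ grading j → a • m ∈ grading (i + j)

attribute [instance] GradedModuleOver.isAddCommGroup GradedModuleOver.isModule
  GradedModuleOver.isDecomposition

/-- A bundled module over a ring `A`. -/
structure ModuleOver (A : Type u) [Ring A] : Type (u + 1) where
  carrier : Type u
  [isAddCommGroup : AddCommGroup carrier]
  [isModule : Module A carrier]

attribute [instance] ModuleOver.isAddCommGroup ModuleOver.isModule

section
variable {A : Type u} [Ring A] {𝒜 : ℤ → AddSubgroup A}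

/-- A linear map is a morphism of graded modules (of degree `0`) if it preserves
the gradings. -/
def IsGradedHom (M N : GradedModuleOver A 𝒜) (f : M.carrier →ₗ[A] N.carrier) :
    Prop :=
  ∀ (j : ℤ), ∀ x ∈ M.grading j, f x ∈ N.grading j

/-- A submodule of a graded module is graded if it is stable under taking
homogeneous components. -/
def IsGradedSubmodule (M : GradedModuleOver A 𝒜) (p : Submodule A M.carrier) :
    Prop :=
  ∀ (j : ℤ), ∀ x ∈ p, (DirectSum.decompose M.grading x j : M.carrier) ∈ p

/-- Projectivity in the category of graded modules with degree-`0` morphisms. -/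
def IsGradedProjective (P : GradedModuleOver A 𝒜) : Prop :=
  ∀ (X Y : GradedModuleOver A 𝒜) (g : X.carrier →ₗ[A] Y.carrier)
    (h : P.carrier →ₗ[A] Y.carrier),
    IsGradedHom X Y g → Function.Surjective g → IsGradedHom P Y h →
    ∃ f : P.carrier →ₗ[A] X.carrier, IsGradedHom P X f ∧ g ∘ₗ f = h

/-- Indecomposability in the category of graded modules: the module is nonzero
and admits no decomposition into two nonzero complementary graded submodules. -/
def IsGradedIndecomposable (P : GradedModuleOver A 𝒜) : Prop :=
  Nontrivial P.carrier ∧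
    ∀ p q : Submodule A P.carrier, IsGradedSubmodule P p → IsGradedSubmodule P q →
      IsCompl p q → p = ⊥ ∨ q = ⊥

/-- Isomorphism of graded modules up to a shift of the grading. -/
def ShiftIsoRel (M N : GradedModuleOver A 𝒜) : Prop :=
  ∃ (i : ℤ) (e : M.carrier ≃ₗ[A] N.carrier),
    ∀ (j : ℤ), ∀ x ∈ M.grading j, e x ∈ N.grading (i + j)

/-- An indecomposable projective ungraded module. -/
def IsIndecProjective (L : ModuleOver A) : Prop :=
  Module.Projective A L.carrier ∧ Nontrivial L.carrier ∧
    ∀ p q : Submodule A L.carrier, IsCompl p q → p = ⊥ ∨ q = ⊥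

end

section FiniteLength

variable {R : Type*} [Ring R] {M : Type*} [AddCommGroup M] [Module R M]

/-- A multiplicatively closed set of nilpotent endomorphisms of a module of finite length
generates a nilpotent action: no nonzero stable submodule is spanned by its images. -/
theorem Submodule.eq_bot_of_le_iSup_map_of_isNilpotent [IsNoetherian R M] [IsArtinian R M]
    (S : Set (Module.End R M)) (hmul : ∀ s ∈ S, ∀ t ∈ S, s * t ∈ S)
    (hnil : ∀ s ∈ S, IsNilpotent s) (N : Submodule R M)
    (hstable : ∀ s ∈ S, N.map s ≤ N) (hN : N ≤ ⨆ s ∈ S, N.map s) : N = ⊥ := by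
  by_contra hne
  obtain ⟨K, ⟨hKN, hKS⟩, hKmax⟩ := WellFounded.has_min
    (wellFounded_gt (α := Submodule R M)) {K | K < N ∧ ∀ s ∈ S, K.map s ≤ K}
    ⟨⊥, bot_lt_iff_ne_bot.2 hne, by simp⟩
  have hex : ∃ s ∈ S, ¬ N.map s ≤ K := by
    by_contra! h
    exact hKN.not_ge (hN.trans (iSup₂_le h))
  obtain ⟨_, ⟨s, hs, hsK, rfl⟩, hmin⟩ := WellFounded.has_min
    (wellFounded_lt (α := Submodule R M)) {W | ∃ s ∈ S, ¬ N.map s ≤ K ∧ N.map s ⊔ K = W}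
    (by obtain ⟨s, hs, h⟩ := hex; exact ⟨_, s, hs, h, rfl⟩)
  have key : ∀ v ∈ S, N.map v ≤ N.map s → N.map (v * s) ≤ K := by
    intro v hv hvs
    by_contra hvK
    have hle : N.map (v * s) ≤ N.map s := by
      rw [Module.End.mul_eq_comp, Submodule.map_comp]
      exact (Submodule.map_mono (hstable s hs)).trans hvs
    have heq : N.map (v * s) ⊔ K = N.map s ⊔ K :=
      eq_of_le_of_not_lt (sup_le_sup_right hle K) (hmin _ ⟨_, hmul v hv s hs, hvK, rfl⟩)
    have hpow : ∀ n : ℕ, N.map s ⊔ K ≤ (N.map s).map (v ^ n) ⊔ K := by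
      intro n
      induction n with
      | zero => simp [Module.End.one_eq_id]
      | succ n ih =>
        have h1 : N.map s ⊔ K ≤ (N.map s ⊔ K).map v ⊔ K := by
          rw [Submodule.map_sup, ← Submodule.map_comp, ← Module.End.mul_eq_comp, sup_right_comm,
            heq]
          exact le_sup_left
        refine h1.trans (sup_le ((Submodule.map_mono ih).trans ?_) le_sup_right)
        rw [Submodule.map_sup, ← Submodule.map_comp, ← Module.End.mul_eq_comp, ← pow_succ']
        exact sup_le_sup_left (hKS v hv) _
    obtain ⟨n, hn⟩ := hnil v hv
    have := hpow n
    rw [hn, Submodule.map_zero, bot_sup_eq] at this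
    exact hsK (le_sup_left.trans this)
  let U := N.map s ⊔ (⨆ t ∈ S, N.map (t * s)) ⊔ K
  have hmaps : ∀ t ∈ S, N.map (t * s) ≤ U := fun t ht ↦
    (le_iSup₂ (f := fun t (_ : t ∈ S) ↦ N.map (t * s)) t ht).trans
      (le_sup_right.trans le_sup_left)
  have hUN : U ≤ N := sup_le (sup_le (hstable s hs)
    (iSup₂_le fun t ht ↦ hstable _ (hmul t ht s hs))) hKN.le
  have hUS : ∀ t ∈ S, U.map t ≤ U := by
    intro t ht
    simp only [U, Submodule.map_sup, Submodule.map_iSup]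
    refine sup_le (sup_le ?_ (iSup₂_le fun t' ht' ↦ ?_)) ((hKS t ht).trans le_sup_right)
    · rw [← Submodule.map_comp, ← Module.End.mul_eq_comp]
      exact hmaps t ht
    · rw [← Submodule.map_comp, ← Module.End.mul_eq_comp, ← mul_assoc]
      exact hmaps _ (hmul t ht t' ht')
  have hKU : K < U := lt_of_le_of_ne le_sup_right fun h ↦
    hsK ((le_sup_left.trans le_sup_left : N.map s ≤ U).trans h.ge)
  have hU : U = N := eq_of_le_of_not_lt hUN fun h ↦ hKmax U ⟨h, hUS⟩ hKU
  apply hsK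
  rw [← hU]
  simp only [U, Submodule.map_sup, Submodule.map_iSup]
  refine sup_le (sup_le ?_ (iSup₂_le fun t ht ↦ ?_)) (hKS s hs)
  · rw [← Submodule.map_comp, ← Module.End.mul_eq_comp]
    exact key s hs le_rfl
  · rw [← Submodule.map_comp, ← Module.End.mul_eq_comp, ← mul_assoc]
    refine key _ (hmul s hs t ht) ?_
    rw [Module.End.mul_eq_comp, Submodule.map_comp]
    exact Submodule.map_mono (hstable t ht)

/-- Fitting's lemma for a single endomorphism. -/
theorem isNilpotent_or_bijective_of_isCompl_ker_range_pow [IsNoetherian R M] [IsArtinian R M]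
    (f : Module.End R M) (h : ∀ n : ℕ, IsCompl (LinearMap.ker (f ^ n)) (LinearMap.range (f ^ n)) →
      LinearMap.ker (f ^ n) = ⊥ ∨ LinearMap.range (f ^ n) = ⊥) :
    IsNilpotent f ∨ Function.Bijective f := by
  obtain ⟨n, hn, hn0⟩ := (f.eventually_isCompl_ker_pow_range_pow.and
    (Filter.eventually_gt_atTop 0)).exists
  obtain hk | hr := h n hn
  · right
    apply IsArtinian.bijective_of_injective_endomorphism
    obtain ⟨m, rfl⟩ := Nat.exists_eq_succ_of_ne_zero hn0.ne'
    have := LinearMap.ker_eq_bot.1 hk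
    rw [pow_succ, Module.End.coe_mul] at this
    exact this.of_comp
  · exact Or.inl ⟨n, LinearMap.range_eq_bot.1 hr⟩

theorem isNilpotent_or_bijective_of_indecomposable [IsNoetherian R M] [IsArtinian R M]
    (h : ∀ p q : Submodule R M, IsCompl p q → p = ⊥ ∨ q = ⊥) (f : Module.End R M) :
    IsNilpotent f ∨ Function.Bijective f :=
  isNilpotent_or_bijective_of_isCompl_ker_range_pow f fun _ hn ↦ h _ _ hn

/-- If a finite sum of endomorphisms of an indecomposable module of finite length is bijective,
then so is one of the summands. -/
theorem exists_bijective_of_bijective_sum [IsNoetherian R M] [IsArtinian R M] [Nontrivial M]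
    (h : ∀ p q : Submodule R M, IsCompl p q → p = ⊥ ∨ q = ⊥) {ι : Type*} (s : Finset ι)
    (f : ι → Module.End R M) (hf : Function.Bijective (∑ i ∈ s, f i : Module.End R M)) :
    ∃ i ∈ s, Function.Bijective (f i) := by
  have : IsLocalRing (Module.End R M) := IsLocalRing.of_isUnit_or_isUnit_one_sub_self fun g ↦ by
    obtain hg | hg := isNilpotent_or_bijective_of_indecomposable h g
    · exact Or.inr hg.isUnit_one_sub
    · exact Or.inl ((Module.End.isUnit_iff g).2 hg)
  by_contra! hs
  have hmem : ∀ t ⊆ s, ∑ i ∈ t, f i ∈ nonunits (Module.End R M) := by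
    classical
    intro t
    induction t using Finset.induction_on with
    | empty => simp
    | insert i t hi ih =>
      intro hts
      rw [Finset.sum_insert hi]
      refine IsLocalRing.nonunits_add ?_ (ih ((Finset.subset_insert i t).trans hts))
      exact fun hu ↦ hs i (hts (Finset.mem_insert_self i t)) ((Module.End.isUnit_iff _).1 hu)
  exact hmem s subset_rfl ((Module.End.isUnit_iff _).2 hf)

theorem not_isNilpotent_of_comp_eq_self {T : Type*} [AddCommGroup T] [Module R T] [Nontrivial T]
    (k : M →ₗ[R] T) (hk : Function.Surjective k) (c : Module.End R M) (hkc : k ∘ₗ c = k) :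
    ¬ IsNilpotent c := by
  rintro ⟨n, hn⟩
  have hpow : ∀ n : ℕ, k ∘ₗ (c ^ n) = k := by
    intro n
    induction n with
    | zero => rfl
    | succ n ih => rw [pow_succ, Module.End.mul_eq_comp, ← LinearMap.comp_assoc, ih, hkc]
  obtain ⟨t, ht⟩ := exists_ne (0 : T)
  obtain ⟨x, rfl⟩ := hk t
  apply ht
  rw [← hpow n, hn]
  simp

/-- Two indecomposable projective modules of finite length with a common simple quotient are
isomorphic. -/
theorem nonempty_linearEquiv_of_common_simple_quotient {L : Type*} [AddCommGroup L] [Module R L]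
    {T : Type*} [AddCommGroup T] [Module R T] [Nontrivial T]
    [IsNoetherian R M] [IsArtinian R M] [IsNoetherian R L] [IsArtinian R L]
    [Module.Projective R M] [Module.Projective R L]
    (hM : ∀ p q : Submodule R M, IsCompl p q → p = ⊥ ∨ q = ⊥)
    (hL : ∀ p q : Submodule R L, IsCompl p q → p = ⊥ ∨ q = ⊥)
    (f : M →ₗ[R] T) (g : L →ₗ[R] T)
    (hf : Function.Surjective f) (hg : Function.Surjective g) : Nonempty (M ≃ₗ[R] L) := by
  obtain ⟨a, ha⟩ := Module.projective_lifting_property g f hg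
  obtain ⟨b, hb⟩ := Module.projective_lifting_property f g hf
  have h1 : Function.Bijective (b ∘ₗ a) :=
    (isNilpotent_or_bijective_of_indecomposable hM (b ∘ₗ a)).resolve_left
      (not_isNilpotent_of_comp_eq_self f hf _ (by rw [← LinearMap.comp_assoc, hb, ha]))
  have h2 : Function.Bijective (a ∘ₗ b) :=
    (isNilpotent_or_bijective_of_indecomposable hL (a ∘ₗ b)).resolve_left
      (not_isNilpotent_of_comp_eq_self g hg _ (by rw [← LinearMap.comp_assoc, ha, hb]))
  refine ⟨LinearEquiv.ofBijective a ⟨?_, ?_⟩⟩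
  · exact Function.Injective.of_comp (f := b) h1.1
  · exact Function.Surjective.of_comp (g := b) h2.2

end FiniteLength

/-- A family of subgroups is an internal direct sum as soon as there are additive maps that
behave like the projections onto its members. -/
theorem DirectSum.isInternal_of_projections {ι M : Type*} [DecidableEq ι] [AddCommGroup M]
    (ℳ : ι → AddSubgroup M) (π : ι → M →+ M) (hmem : ∀ j x, π j x ∈ ℳ j)
    (hfin : ∀ x, {j | π j x ≠ 0}.Finite) (hsame : ∀ j, ∀ x ∈ ℳ j, π j x = x)
    (hne : ∀ j k, ∀ x ∈ ℳ j, k ≠ j → π k x = 0) (hzero : ∀ x, (∀ j, π j x = 0) → x = 0) :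
    DirectSum.IsInternal ℳ := by
  have hπ : ∀ (z : DirectSum ι fun i ↦ ℳ i) (k : ι),
      π k (DirectSum.coeAddMonoidHom ℳ z) = z k := by
    intro z k
    induction z using DirectSum.induction_on with
    | zero => simp
    | of i x =>
      rw [DirectSum.coeAddMonoidHom_of]
      by_cases hik : k = i
      · subst hik
        rw [hsame k x x.2, DirectSum.of_eq_same]
      · rw [hne i k x x.2 hik, DirectSum.of_eq_of_ne _ _ _ hik]
        rfl
    | add x y hx hy => simp [hx, hy]
  constructor
  · rw [injective_iff_map_eq_zero]
    intro z hz
    ext k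
    rw [← hπ, hz, map_zero]
    rfl
  · intro x
    classical
    refine ⟨DirectSum.mk _ (hfin x).toFinset fun j ↦ ⟨π j x, hmem j x⟩, ?_⟩
    rw [← sub_eq_zero]
    refine hzero _ fun j ↦ ?_
    rw [map_sub, hπ, sub_eq_zero]
    by_cases hj : j ∈ (hfin x).toFinset
    · rw [DirectSum.mk_apply_of_mem hj]
    · rw [DirectSum.mk_apply_of_notMem hj]
      simpa [eq_comm] using hj

namespace GradedModuleOver

variable {A : Type u} [Ring A] {𝒜 : ℤ → AddSubgroup A}

/-- The projection of a graded module onto its component of degree `j`. -/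
def proj (M : GradedModuleOver A 𝒜) (j : ℤ) : M.carrier →+ M.carrier where
  toFun x := DirectSum.decompose M.grading x j
  map_zero' := by simp
  map_add' x y := by simp

variable (M N : GradedModuleOver A 𝒜)

theorem proj_mem (j : ℤ) (x : M.carrier) : M.proj j x ∈ M.grading j :=
  (DirectSum.decompose M.grading x j).2

variable {M N}

theorem proj_of_mem {j : ℤ} {x : M.carrier} (hx : x ∈ M.grading j) : M.proj j x = x :=
  DirectSum.decompose_of_mem_same _ hx

theorem proj_of_mem_ne {j k : ℤ} {x : M.carrier} (hx : x ∈ M.grading j) (h : k ≠ j) :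
    M.proj k x = 0 :=
  DirectSum.decompose_of_mem_ne _ hx h.symm

theorem finite_proj_ne_zero (x : M.carrier) : {j | M.proj j x ≠ 0}.Finite := by
  classical
  refine (DFinsupp.support (DirectSum.decompose M.grading x)).finite_toSet.subset fun j hj ↦ ?_
  simpa [proj] using hj

theorem eventually_sum_proj (x : M.carrier) :
    ∀ᶠ F : Finset ℤ in Filter.atTop, ∑ j ∈ F, M.proj j x = x := by
  classical
  filter_upwards [Filter.eventually_ge_atTop
    (DFinsupp.support (DirectSum.decompose M.grading x))] with F hF
  conv_rhs => rw [← DirectSum.sum_support_decompose M.grading x]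
  refine (Finset.sum_subset hF fun j _ hj ↦ ?_).symm
  simpa [proj] using hj

theorem induction_on {motive : M.carrier → Prop} (x : M.carrier) (zero : motive 0)
    (homogeneous : ∀ j, ∀ x ∈ M.grading j, motive x)
    (add : ∀ x y, motive x → motive y → motive (x + y)) : motive x :=
  DirectSum.Decomposition.inductionOn M.grading zero (fun m ↦ homogeneous _ m m.2) add x

theorem eq_zero_of_proj {x : M.carrier} (h : ∀ j, M.proj j x = 0) : x = 0 := by
  obtain ⟨F, hF⟩ := (eventually_sum_proj x).exists
  rw [← hF]
  exact Finset.sum_eq_zero fun j _ ↦ h j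

theorem exists_proj_add_mul_eq_zero (x : M.carrier) {i : ℤ} (hi : i ≠ 0) (k : ℤ) :
    ∃ n : ℕ, M.proj (k + n * i) x = 0 := by
  by_contra! h
  refine Set.infinite_range_of_injective (f := fun n : ℕ ↦ k + n * i) (fun a b hab ↦ ?_)
    ((finite_proj_ne_zero x).subset (Set.range_subset_iff.2 h))
  simpa [hi] using hab

theorem proj_smul {i : ℤ} {a : A} (ha : a ∈ 𝒜 i) (j : ℤ) (x : M.carrier) :
    M.proj (i + j) (a • x) = a • M.proj j x := by
  induction x using induction_on with
  | zero => simp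
  | homogeneous k x hx =>
    by_cases h : j = k
    · subst h
      rw [proj_of_mem hx, proj_of_mem (M.smul_mem ha hx)]
    · rw [proj_of_mem_ne hx h, proj_of_mem_ne (M.smul_mem ha hx) (by simpa using h), smul_zero]
  | add x y hx hy => simp [hx, hy]

/-- A linear map between graded modules is homogeneous of degree `i` if it raises degrees
by `i`. -/
def IsHomogeneousHom (i : ℤ) (f : M.carrier →ₗ[A] N.carrier) : Prop :=
  ∀ (j : ℤ), ∀ x ∈ M.grading j, f x ∈ N.grading (i + j)

theorem IsHomogeneousHom.proj_apply {i : ℤ} {f : M.carrier →ₗ[A] N.carrier}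
    (hf : IsHomogeneousHom i f) (j : ℤ) (x : M.carrier) :
    N.proj (i + j) (f x) = f (M.proj j x) := by
  induction x using induction_on with
  | zero => simp
  | homogeneous k x hx =>
    by_cases h : j = k
    · subst h
      rw [proj_of_mem hx, proj_of_mem (hf _ _ hx)]
    · rw [proj_of_mem_ne hx h, proj_of_mem_ne (hf _ _ hx) (by simpa using h), map_zero]
  | add x y hx hy => simp [hx, hy]

theorem IsHomogeneousHom.proj_apply' {i : ℤ} {f : M.carrier →ₗ[A] N.carrier}
    (hf : IsHomogeneousHom i f) (j : ℤ) (x : M.carrier) :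
    N.proj j (f x) = f (M.proj (j - i) x) := by
  rw [← hf.proj_apply, add_sub_cancel]

theorem IsHomogeneousHom.mul {i j : ℤ} {f g : Module.End A M.carrier}
    (hf : IsHomogeneousHom (M := M) (N := M) i f) (hg : IsHomogeneousHom (M := M) (N := M) j g) :
    IsHomogeneousHom (M := M) (N := M) (i + j) (f * g) := fun k x hx ↦ by
  rw [add_assoc]
  exact hf _ _ (hg _ _ hx)

theorem IsHomogeneousHom.pow {i : ℤ} {f : Module.End A M.carrier}
    (hf : IsHomogeneousHom (M := M) (N := M) i f) (n : ℕ) :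
    IsHomogeneousHom (M := M) (N := M) (n * i) (f ^ n) := by
  induction n with
  | zero => intro k x hx; simpa using hx
  | succ n ih =>
    rw [pow_succ, show ((n + 1 : ℕ) : ℤ) * i = n * i + i by push_cast; ring]
    exact ih.mul hf

theorem IsHomogeneousHom.isGradedSubmodule_ker {i : ℤ} {f : M.carrier →ₗ[A] N.carrier}
    (hf : IsHomogeneousHom i f) : IsGradedSubmodule M (LinearMap.ker f) := fun j x hx ↦ by
  rw [LinearMap.mem_ker] at hx ⊢
  change f (M.proj j x) = 0
  rw [← hf.proj_apply, hx, map_zero]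

theorem IsHomogeneousHom.isGradedSubmodule_range {i : ℤ} {f : M.carrier →ₗ[A] N.carrier}
    (hf : IsHomogeneousHom i f) : IsGradedSubmodule N (LinearMap.range f) := by
  rintro j _ ⟨x, rfl⟩
  exact ⟨M.proj (j - i) x, (hf.proj_apply' j x).symm⟩

theorem IsHomogeneousHom.symm {i : ℤ} {e : M.carrier ≃ₗ[A] N.carrier}
    (he : IsHomogeneousHom i e.toLinearMap) : IsHomogeneousHom (-i) e.symm.toLinearMap := by
  intro j x hx
  have h : e (M.proj (j - i) (e.symm x)) = x := by
    have := he.proj_apply' j (e.symm x)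
    simp only [LinearEquiv.coe_coe, LinearEquiv.apply_symm_apply] at this
    rw [← this, proj_of_mem hx]
  have h' : e.symm x = M.proj (j - i) (e.symm x) := by rw [LinearEquiv.symm_apply_eq, h]
  rw [LinearEquiv.coe_coe, h', neg_add_eq_sub]
  exact M.proj_mem _ _

section component

variable [GradedRing 𝒜]

/-- The homogeneous component of degree `i` of a linear map between graded modules. -/
def component (f : M.carrier →ₗ[A] N.carrier) (i : ℤ) : M.carrier →ₗ[A] N.carrier :=
  let c : M.carrier →+ N.carrier :=
    (DirectSum.toAddMonoid fun j ↦ (N.proj (i + j)).comp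
      (f.toAddMonoidHom.comp (M.grading j).subtype)).comp
      (DirectSum.decomposeAddEquiv M.grading).toAddMonoidHom
  have hc : ∀ j, ∀ x ∈ M.grading j, c x = N.proj (i + j) (f x) := fun j x hx ↦ by
    simp [c, DirectSum.decompose_of_mem _ hx]
  { c with
    map_smul' := fun a x ↦ by
      change c (a • x) = a • c x
      induction x using induction_on with
      | zero => simp
      | homogeneous j x hx =>
        induction a using DirectSum.Decomposition.inductionOn 𝒜 with
        | zero => simp
        | @homogeneous k a =>
          rw [hc _ _ (M.smul_mem a.2 hx), hc _ _ hx, map_smul, ← proj_smul a.2]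
          congr 2
          ring
        | add a b ha hb => simp [add_smul, ha, hb]
      | add x y hx hy => simp [hx, hy] }

theorem component_of_mem (f : M.carrier →ₗ[A] N.carrier) (i : ℤ) {j : ℤ} {x : M.carrier}
    (hx : x ∈ M.grading j) : component f i x = N.proj (i + j) (f x) := by
  change (DirectSum.toAddMonoid fun j ↦ (N.proj (i + j)).comp
      (f.toAddMonoidHom.comp (M.grading j).subtype)) (DirectSum.decompose M.grading x) = _
  simp [DirectSum.decompose_of_mem _ hx]

theorem isHomogeneousHom_component (f : M.carrier →ₗ[A] N.carrier) (i : ℤ) :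
    IsHomogeneousHom i (component f i) := fun j x hx ↦ by
  rw [component_of_mem f i hx]
  exact N.proj_mem _ _

theorem eventually_sum_component_apply (f : M.carrier →ₗ[A] N.carrier) (x : M.carrier) :
    ∀ᶠ F : Finset ℤ in Filter.atTop, ∑ i ∈ F, component f i x = f x := by
  induction x using induction_on with
  | zero => simp
  | homogeneous j x hx =>
    have : Filter.Tendsto (fun F : Finset ℤ ↦ F.map (addRightEmbedding j))
        Filter.atTop Filter.atTop := by
      rw [Filter.tendsto_atTop]
      intro G
      filter_upwards [Filter.eventually_ge_atTop (G.map (addRightEmbedding (-j)))] with F hF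
      intro k hk
      have := hF (Finset.mem_map_of_mem (addRightEmbedding (-j)) hk)
      simpa using Finset.mem_map_of_mem (addRightEmbedding j) this
    filter_upwards [this.eventually (eventually_sum_proj (f x))] with F hF
    rw [← hF, Finset.sum_map]
    exact Finset.sum_congr rfl fun i _ ↦ component_of_mem f i hx
  | add x y hx hy =>
    filter_upwards [hx, hy] with F h1 h2
    simp [Finset.sum_add_distrib, h1, h2]

theorem eventually_sum_component [Module.Finite A M.carrier] (f : M.carrier →ₗ[A] N.carrier) :
    ∀ᶠ F : Finset ℤ in Filter.atTop, ∑ i ∈ F, component f i = f := by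
  obtain ⟨G, hG⟩ := Module.Finite.fg_top (R := A) (M := M.carrier)
  have := (Filter.eventually_all_finset G).2 fun x _ ↦ eventually_sum_component_apply f x
  filter_upwards [this] with F hF
  refine LinearMap.ext_on hG fun x hx ↦ ?_
  simpa using hF x hx

end component

/-- A nonzero graded module of finite length has no injective homogeneous endomorphism of
nonzero degree. -/
theorem IsHomogeneousHom.not_injective [IsArtinian A M.carrier] [Nontrivial M.carrier] {i : ℤ}
    (hi : i ≠ 0) {f : Module.End A M.carrier} (hf : IsHomogeneousHom (M := M) (N := M) i f) :
    ¬ Function.Injective f := by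
  intro hinj
  have hpow : ∀ (n : ℕ), Function.Injective (f ^ n : Module.End A M.carrier) := fun n ↦ by
    rw [Module.End.coe_pow]
    exact hinj.iterate n
  have hshift : ∀ (y : M.carrier) (k : ℤ),
      (∀ n : ℕ, M.proj (k + (n + 1 : ℕ) * i) y = f (M.proj (k + n * i) y)) →
        M.proj k y = 0 := by
    intro y k h
    have hn : ∀ n : ℕ, M.proj (k + n * i) y = (f ^ n) (M.proj k y) := by
      intro n
      induction n with
      | zero => simp
      | succ n ih => rw [h, ih, pow_succ', Module.End.mul_apply]
    obtain ⟨n, h0⟩ := exists_proj_add_mul_eq_zero y hi k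
    rw [hn] at h0
    exact hpow n (h0.trans (map_zero _).symm)
  have hstep : ∀ (y : M.carrier) (k : ℤ),
      M.proj (k + i) ((1 - f) y) = M.proj (k + i) y - f (M.proj k y) := by
    intro y k
    rw [LinearMap.sub_apply, map_sub, Module.End.one_apply, add_comm k i, hf.proj_apply]
  have hinj1 : Function.Injective (1 - f : Module.End A M.carrier) := by
    rw [injective_iff_map_eq_zero]
    intro y hy
    refine eq_zero_of_proj fun k ↦ hshift y k fun n ↦ ?_
    have := hstep y (k + n * i)
    rw [hy, map_zero, eq_comm, sub_eq_zero] at this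
    rw [← this]
    congr 2
    push_cast
    ring
  have hsurj := IsArtinian.surjective_of_injective_endomorphism _ hinj1
  obtain ⟨z, hz⟩ := exists_ne (0 : M.carrier)
  obtain ⟨d, hd⟩ : ∃ d, M.proj d z ≠ 0 := by
    by_contra! h
    exact hz (eq_zero_of_proj h)
  obtain ⟨y, hy⟩ := hsurj (M.proj d z)
  have hstep' : ∀ k, k + i ≠ d → M.proj (k + i) y = f (M.proj k y) := by
    intro k hk
    rw [← sub_eq_zero, ← hstep, hy, proj_of_mem_ne (M.proj_mem d z) hk]
  have hback : M.proj (d - i) y = 0 := by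
    obtain ⟨n, hn⟩ := exists_proj_add_mul_eq_zero y (neg_ne_zero.2 hi) (d - i)
    have : ∀ m : ℕ, M.proj (d - i) y = (f ^ m) (M.proj (d - i + m * -i) y) := by
      intro m
      induction m with
      | zero => simp
      | succ m ih =>
        rw [ih, pow_succ, Module.End.mul_apply, ← hstep']
        · congr 3
          push_cast
          ring
        · intro h
          have h' : ((m : ℤ) + 1) * i = 0 := by push_cast at h; linarith
          rcases mul_eq_zero.1 h' with h' | h'
          · omega
          · exact hi h'
    rw [this n, hn, map_zero]
  have hd0 : M.proj d y = 0 := by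
    refine hshift y d fun n ↦ ?_
    rw [← hstep']
    · congr 2
      push_cast
      ring
    · intro h
      have h' : ((n : ℤ) + 1) * i = 0 := by linarith
      rcases mul_eq_zero.1 h' with h' | h'
      · omega
      · exact hi h'
  have := hstep y (d - i)
  rw [hback, map_zero, sub_zero, sub_add_cancel, hd0, hy, proj_of_mem (M.proj_mem d z)] at this
  exact hd this

theorem IsHomogeneousHom.isNilpotent_or_bijective [IsNoetherian A M.carrier]
    [IsArtinian A M.carrier] (hM : IsGradedIndecomposable M) {i : ℤ}
    {f : Module.End A M.carrier} (hf : IsHomogeneousHom (M := M) (N := M) i f) :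
    IsNilpotent f ∨ Function.Bijective f :=
  isNilpotent_or_bijective_of_isCompl_ker_range_pow f fun n hn ↦
    hM.2 _ _ (hf.pow n).isGradedSubmodule_ker (hf.pow n).isGradedSubmodule_range hn

/-- An endomorphism of a graded indecomposable module of finite length whose component of
degree `0` is bijective is itself injective. -/
theorem injective_of_bijective_component_zero [GradedRing 𝒜] [IsNoetherian A M.carrier]
    [IsArtinian A M.carrier] (hM : IsGradedIndecomposable M) (f : Module.End A M.carrier)
    (hf : Function.Bijective (component (M := M) (N := M) f 0)) : Function.Injective f := by
  classical
  have := hM.1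
  let S : Set (Module.End A M.carrier) :=
    {s | (∃ i, IsHomogeneousHom (M := M) (N := M) i s) ∧ ¬ Function.Bijective s}
  have hnil : ∀ s ∈ S, IsNilpotent s := fun s ⟨⟨i, hi⟩, hs⟩ ↦
    (hi.isNilpotent_or_bijective hM).resolve_right hs
  have hmul : ∀ s ∈ S, ∀ t ∈ S, s * t ∈ S := by
    rintro s ⟨⟨i, hi⟩, hs⟩ t ⟨⟨j, hj⟩, -⟩
    refine ⟨⟨i + j, hi.mul hj⟩, fun h ↦ hs ?_⟩
    exact IsNoetherian.bijective_of_surjective_endomorphism s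
      (Function.Surjective.of_comp (g := t) h.2)
  let e : M.carrier ≃ₗ[A] M.carrier := LinearEquiv.ofBijective _ hf
  have he : IsHomogeneousHom 0 e.toLinearMap := isHomogeneousHom_component f 0
  have hcomp : ∀ i ≠ 0, (e.symm.toLinearMap ∘ₗ component f i : Module.End A M.carrier) ∈ S := by
    intro i hi
    refine ⟨⟨-0 + i, IsHomogeneousHom.mul he.symm (isHomogeneousHom_component f i)⟩, fun h ↦ ?_⟩
    exact (isHomogeneousHom_component f i).not_injective hi
      (Function.Injective.of_comp (f := e.symm) h.1)
  obtain ⟨F, hF, hF0⟩ := ((eventually_sum_component f).and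
    (Filter.eventually_ge_atTop {(0 : ℤ)})).exists
  have hF0 : (0 : ℤ) ∈ F := hF0 (Finset.mem_singleton_self 0)
  let K := LinearMap.ker f
  let W := ⨆ s ∈ S, K.map s
  have hKW : K ≤ W := by
    intro x hx
    have h0 : e x + ∑ i ∈ F.erase 0, component f i x = 0 := by
      have hfx : f x = 0 := hx
      rw [← hF, LinearMap.sum_apply, ← Finset.add_sum_erase _ _ hF0] at hfx
      exact hfx
    have hx' : x = -∑ i ∈ F.erase 0, e.symm (component f i x) := by
      rw [← map_sum, ← map_neg, LinearEquiv.eq_symm_apply, eq_neg_iff_add_eq_zero, h0]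
    rw [hx']
    refine neg_mem (sum_mem fun i hi ↦ ?_)
    exact (le_iSup₂ (f := fun s (_ : s ∈ S) ↦ K.map s) _ (hcomp i (Finset.ne_of_mem_erase hi)))
      (Submodule.mem_map_of_mem (f := e.symm.toLinearMap ∘ₗ component f i) hx)
  have hW : W = ⊥ := by
    refine Submodule.eq_bot_of_le_iSup_map_of_isNilpotent S hmul hnil W (fun s hs ↦ ?_)
      (iSup₂_mono fun s _ ↦ Submodule.map_mono hKW)
    simp only [W, Submodule.map_iSup]
    refine iSup₂_le fun t ht ↦ ?_
    rw [← Submodule.map_comp]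
    exact le_iSup₂ (f := fun s (_ : s ∈ S) ↦ K.map s) _ (hmul s hs t ht)
  exact LinearMap.ker_eq_bot.1 (le_bot_iff.1 (hKW.trans hW.le))

theorem component_zero_add_component_zero [GradedRing 𝒜] {f g : Module.End A M.carrier}
    (h : f + g = 1) :
    component (M := M) (N := M) f 0 + component (M := M) (N := M) g 0 = LinearMap.id := by
  ext x
  induction x using induction_on with
  | zero => simp
  | homogeneous j x hx =>
    rw [LinearMap.add_apply, component_of_mem _ _ hx, component_of_mem _ _ hx, ← map_add,
      ← LinearMap.add_apply, h, zero_add, Module.End.one_apply, proj_of_mem hx]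
    rfl
  | add x y hx hy => rw [map_add, hx, hy, map_add]

/-- A graded indecomposable module of finite length is indecomposable. -/
theorem indecomposable_of_isGradedIndecomposable [GradedRing 𝒜] [IsNoetherian A M.carrier]
    [IsArtinian A M.carrier] (hM : IsGradedIndecomposable M) (p q : Submodule A M.carrier)
    (hpq : IsCompl p q) : p = ⊥ ∨ q = ⊥ := by
  have hadd : p.projection q hpq + q.projection p hpq.symm = 1 :=
    Submodule.projection_add_projection_eq_id hpq
  have h0 := component_zero_add_component_zero hadd
  obtain h | h := (isHomogeneousHom_component (M := M) (N := M)
    (p.projection q hpq) 0).isNilpotent_or_bijective hM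
  · left
    have hu : IsUnit (component (M := M) (N := M) (q.projection p hpq.symm) 0 :
        Module.End A M.carrier) := by
      rw [← eq_sub_iff_add_eq'] at h0
      rw [h0]
      exact h.isUnit_one_sub
    have := injective_of_bijective_component_zero hM _ ((Module.End.isUnit_iff _).1 hu)
    rw [← Submodule.ker_projection hpq.symm]
    exact LinearMap.ker_eq_bot.2 this
  · right
    have := injective_of_bijective_component_zero hM _ h
    rw [← Submodule.ker_projection hpq]
    exact LinearMap.ker_eq_bot.2 this

/-- Linearly isomorphic graded indecomposable modules of finite length are isomorphic as graded
modules up to a shift. -/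
theorem shiftIsoRel_of_linearEquiv [GradedRing 𝒜] [IsNoetherian A M.carrier]
    [IsArtinian A M.carrier] (hM : IsGradedIndecomposable M)
    (e : M.carrier ≃ₗ[A] N.carrier) : ShiftIsoRel M N := by
  have := hM.1
  obtain ⟨F, hF⟩ := (eventually_sum_component (M := M) (N := N) e.toLinearMap).exists
  have hsum : ∑ i ∈ F, (e.symm.toLinearMap ∘ₗ component e.toLinearMap i :
      Module.End A M.carrier) = 1 := by
    ext x
    have := LinearMap.congr_fun hF x
    simp only [LinearMap.sum_apply, LinearEquiv.coe_coe] at this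
    simp [← map_sum, this]
  obtain ⟨i, -, hi⟩ := exists_bijective_of_bijective_sum
    (indecomposable_of_isGradedIndecomposable hM) F
    (fun i ↦ e.symm.toLinearMap ∘ₗ component e.toLinearMap i)
    (by rw [hsum]; exact Function.bijective_id)
  have hbij : Function.Bijective (component (M := M) (N := N) e.toLinearMap i) :=
    (Function.Bijective.of_comp_iff' e.symm.bijective _).1 hi
  exact ⟨i, LinearEquiv.ofBijective _ hbij, isHomogeneousHom_component e.toLinearMap i⟩

section constructions

/-- A graded ring as a graded module over itself. -/
abbrev regular (𝒜 : ℤ → AddSubgroup A) [GradedRing 𝒜] : GradedModuleOver A 𝒜 where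
  carrier := A
  grading := 𝒜
  smul_mem := fun _ _ _ _ ha hm ↦ SetLike.mul_mem_graded ha hm

theorem isInternal_free [GradedRing 𝒜] {ι : Type u} [Finite ι] (d : ι → ℤ) :
    DirectSum.IsInternal fun j : ℤ ↦
      AddSubgroup.pi (Set.univ : Set ι) fun k ↦ 𝒜 (j - d k) := by
  refine DirectSum.isInternal_of_projections _ (fun j ↦ AddMonoidHom.mk'
    (fun (f : ι → A) k ↦ (regular 𝒜).proj (j - d k) (f k)) fun f g ↦ by ext k; simp)
    ?_ ?_ ?_ ?_ ?_
  · exact fun j f k _ ↦ (regular 𝒜).proj_mem _ _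
  · intro f
    have : ∀ k, {j | (regular 𝒜).proj (j - d k) (f k) ≠ 0}.Finite := fun k ↦
      (finite_proj_ne_zero (M := regular 𝒜) (f k)).preimage sub_left_injective.injOn
    refine (Set.finite_iUnion this).subset fun j hj ↦ ?_
    obtain ⟨k, hk⟩ := Function.ne_iff.1 hj
    exact Set.mem_iUnion.2 ⟨k, hk⟩
  · intro j f hf
    ext k
    exact proj_of_mem (M := regular 𝒜) (hf k trivial)
  · intro j l f hf hl
    ext k
    exact proj_of_mem_ne (M := regular 𝒜) (hf k trivial) (by simpa using hl)
  · intro f hf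
    ext k
    refine eq_zero_of_proj (M := regular 𝒜) fun j ↦ ?_
    simpa using congr_fun (hf (j + d k)) k

/-- The graded free module with basis elements of degrees `d k`. -/
noncomputable abbrev free [GradedRing 𝒜] {ι : Type u} [Finite ι] (d : ι → ℤ) :
    GradedModuleOver A 𝒜 where
  carrier := ι → A
  grading j := AddSubgroup.pi (Set.univ : Set ι) fun k ↦ 𝒜 (j - d k)
  isDecomposition := (isInternal_free d).chooseDecomposition
  smul_mem := fun i j a f ha hf k hk ↦ by
    have := SetLike.mul_mem_graded ha (hf k hk)
    rw [← add_sub_assoc] at this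
    exact this

/-- A graded submodule as a graded module. -/
noncomputable abbrev ofSubmodule (M : GradedModuleOver A 𝒜) (p : Submodule A M.carrier)
    (hp : IsGradedSubmodule M p) : GradedModuleOver A 𝒜 where
  carrier := p
  grading j := (M.grading j).comap p.subtype.toAddMonoidHom
  isDecomposition := by
    refine DirectSum.IsInternal.chooseDecomposition _
      (DirectSum.isInternal_of_projections _
      (fun j ↦ AddMonoidHom.mk' (fun x : p ↦ (⟨M.proj j x, hp j x x.2⟩ : p))
        fun x y ↦ by ext; simp) ?_ ?_ ?_ ?_ ?_)
    · exact fun j x ↦ M.proj_mem j x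
    · intro x
      refine (M.finite_proj_ne_zero (x : M.carrier)).subset fun j hj ↦ ?_
      simpa [Subtype.ext_iff] using hj
    · exact fun j x hx ↦ Subtype.ext (proj_of_mem hx)
    · exact fun j k x hx h ↦ Subtype.ext (proj_of_mem_ne hx h)
    · exact fun x hx ↦ Subtype.ext (eq_zero_of_proj fun j ↦ congr_arg Subtype.val (hx j))
  smul_mem := fun i j a x ha hx ↦ M.smul_mem ha hx

theorem coe_proj_ofSubmodule {p : Submodule A M.carrier} (hp : IsGradedSubmodule M p) (j : ℤ)
    (x : p) : p.subtype ((M.ofSubmodule p hp).proj j x) = M.proj j x := by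
  have h : IsHomogeneousHom (M := M.ofSubmodule p hp) (N := M) 0 p.subtype := fun j x hx ↦ by
    rw [zero_add]
    exact hx
  rw [← h.proj_apply, zero_add]
  rfl

end constructions

theorem isGradedProjective_regular [GradedRing 𝒜] : IsGradedProjective (regular 𝒜) := by
  intro X Y g h hg hsurj hh
  obtain ⟨x, hx⟩ := hsurj (h (1 : A))
  have hx0 : g (X.proj 0 x) = h (1 : A) := by
    have hg' : IsHomogeneousHom 0 g := fun j x hx ↦ by rw [zero_add]; exact hg j x hx
    rw [← hg'.proj_apply, hx, zero_add]
    exact proj_of_mem (hh 0 (1 : A) (SetLike.one_mem_graded 𝒜))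
  refine ⟨LinearMap.toSpanSingleton A X.carrier (X.proj 0 x), fun j a ha ↦ ?_, ?_⟩
  · have := X.smul_mem ha (X.proj_mem 0 x)
    rwa [add_zero] at this
  · refine LinearMap.ext_ring (R := A) ?_
    change g ((1 : A) • X.proj 0 x) = _
    rw [one_smul, hx0]

theorem isGradedProjective_ofSubmodule (hM : IsGradedProjective M) {p q : Submodule A M.carrier}
    (hp : IsGradedSubmodule M p) (hq : IsGradedSubmodule M q) (hpq : IsCompl p q) :
    IsGradedProjective (M.ofSubmodule p hp) := by
  have hproj : IsGradedHom M (M.ofSubmodule p hp) (p.projectionOnto q hpq) := by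
    intro j x hx
    change ((p.projectionOnto q hpq x : p) : M.carrier) ∈ M.grading j
    have hadd := Submodule.projection_add_projection_eq_self hpq x
    have h := congr_arg (p.projection q hpq) (congr_arg (M.proj j) hadd)
    rw [map_add, map_add, proj_of_mem hx,
      Submodule.projection_apply_of_mem_left hpq
        (show M.proj j _ ∈ p from hp j _ (Submodule.projection_apply_mem _ _)),
      (Submodule.projection_apply_eq_zero_iff hpq).2
        (show M.proj j _ ∈ q from hq j _ (Submodule.projection_apply_mem _ _)), add_zero] at h
    rw [Submodule.coe_projectionOnto_apply, ← h]
    exact M.proj_mem _ _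
  intro X Y g h hg hsurj hh
  obtain ⟨f, hf, hgf⟩ := hM X Y g (h ∘ₗ p.projectionOnto q hpq) hg hsurj
    fun j x hx ↦ hh _ _ (hproj _ _ hx)
  refine ⟨f ∘ₗ p.subtype, fun j x hx ↦ hf _ _ hx, ?_⟩
  rw [← LinearMap.comp_assoc, hgf]
  refine LinearMap.ext fun x ↦ ?_
  exact congr_arg h (Submodule.projectionOnto_apply_left hpq x)

theorem exists_finite_homogeneous_span_eq_top (M : GradedModuleOver A 𝒜)
    [Module.Finite A M.carrier] : ∃ H : Set M.carrier, H.Finite ∧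
      (∀ x ∈ H, ∃ j, x ∈ M.grading j) ∧ Submodule.span A H = ⊤ := by
  obtain ⟨G, hG⟩ := Module.Finite.fg_top (R := A) (M := M.carrier)
  refine ⟨⋃ g ∈ G, Set.range fun j ↦ M.proj j g, ?_, ?_, ?_⟩
  · refine G.finite_toSet.biUnion fun g _ ↦ ?_
    refine (((finite_proj_ne_zero g).image fun j ↦ M.proj j g).insert 0).subset ?_
    rintro _ ⟨j, rfl⟩
    by_cases hj : M.proj j g = 0
    · exact Or.inl hj
    · exact Or.inr ⟨j, hj, rfl⟩
  · intro x hx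
    simp only [Set.mem_iUnion] at hx
    obtain ⟨g, -, j, rfl⟩ := hx
    exact ⟨j, M.proj_mem j g⟩
  · rw [eq_top_iff, ← hG, Submodule.span_le]
    intro g hg
    obtain ⟨F, hF⟩ := (eventually_sum_proj g).exists
    rw [SetLike.mem_coe, ← hF]
    refine sum_mem fun j _ ↦ Submodule.subset_span ?_
    exact Set.mem_biUnion hg ⟨j, rfl⟩

/-- A finitely generated graded projective module is projective. -/
theorem projective_of_isGradedProjective [GradedRing 𝒜] [Module.Finite A M.carrier]
    (hM : IsGradedProjective M) : Module.Projective A M.carrier := by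
  obtain ⟨H, hfin, hdeg, hspan⟩ := exists_finite_homogeneous_span_eq_top M
  have := hfin.to_subtype
  have := Fintype.ofFinite H
  choose d hd using fun x : H ↦ hdeg x x.2
  let g : (H → A) →ₗ[A] M.carrier := Fintype.linearCombination A ((↑) : H → M.carrier)
  have hsurj : Function.Surjective g := by
    rw [← LinearMap.range_eq_top, Fintype.range_linearCombination, Subtype.range_coe, hspan]
  have hg : IsGradedHom (free (𝒜 := 𝒜) d) M g := by
    intro j f hf
    change Fintype.linearCombination A ((↑) : H → M.carrier) f ∈ _
    rw [Fintype.linearCombination_apply]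
    refine sum_mem fun k _ ↦ ?_
    have := M.smul_mem (hf k trivial) (hd k)
    rwa [sub_add_cancel] at this
  obtain ⟨s, -, hs⟩ := hM (free (𝒜 := 𝒜) d) M g LinearMap.id hg hsurj fun _ _ hx ↦ hx
  exact Module.Projective.of_split (P := M.carrier) (M := H → A) s g hs

/-- Every nonzero linear map out of a graded artinian module is nonzero on some
graded indecomposable direct summand. -/
theorem exists_isGradedIndecomposable_summand [IsArtinian A M.carrier] {T : Type*}
    [AddCommGroup T] [Module A T] {f : M.carrier →ₗ[A] T} (hf : f ≠ 0) :
    ∃ (p q : Submodule A M.carrier) (hp : IsGradedSubmodule M p), IsGradedSubmodule M q ∧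
      IsCompl p q ∧ f ∘ₗ p.subtype ≠ 0 ∧ IsGradedIndecomposable (M.ofSubmodule p hp) := by
  obtain ⟨p, ⟨q, hp, hq, hpq, hpf⟩, hmin⟩ := WellFounded.has_min
    (wellFounded_lt (α := Submodule A M.carrier))
    {p | ∃ q, IsGradedSubmodule M p ∧ IsGradedSubmodule M q ∧ IsCompl p q ∧ f ∘ₗ p.subtype ≠ 0}
    ⟨⊤, ⊥, fun _ _ _ ↦ trivial, fun j x hx ↦ by
      rw [Submodule.mem_bot] at hx
      simp [hx], isCompl_top_bot, fun h ↦ hf (LinearMap.ext fun x ↦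
        LinearMap.congr_fun h ⟨x, trivial⟩)⟩
  refine ⟨p, q, hp, hq, hpq, hpf, ?_, ?_⟩
  · change Nontrivial p
    rw [Submodule.nontrivial_iff_ne_bot]
    rintro rfl
    exact hpf (LinearMap.ext fun x ↦ by simp [Subsingleton.elim x 0])
  · intro a b ha hb hab
    have hgr : ∀ {a : Submodule A p}, IsGradedSubmodule (M.ofSubmodule p hp) a →
        IsGradedSubmodule M (a.map p.subtype) := by
      rintro a ha j _ ⟨x, hx, rfl⟩
      exact ⟨_, ha j x hx, coe_proj_ofSubmodule hp j x⟩
    have hsup : ∀ {a b : Submodule A p}, IsCompl a b →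
        a.map p.subtype ⊔ b.map p.subtype = p := fun hab ↦ by
      rw [← Submodule.map_sup, hab.sup_eq_top, Submodule.map_subtype_top]
    have main : ∀ {a b : Submodule A p}, IsGradedSubmodule (M.ofSubmodule p hp) a →
        IsGradedSubmodule (M.ofSubmodule p hp) b → IsCompl a b →
        f ∘ₗ (a.map p.subtype).subtype ≠ 0 → b = ⊥ := by
      intro a b ha hb hab hfa
      have hdisj : Disjoint (a.map p.subtype) (b.map p.subtype) := by
        rw [disjoint_iff, ← Submodule.map_inf _ p.subtype_injective, hab.inf_eq_bot,
          Submodule.map_bot]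
      have hmem : a.map p.subtype ∈ {p | ∃ q, IsGradedSubmodule M p ∧ IsGradedSubmodule M q ∧
          IsCompl p q ∧ f ∘ₗ p.subtype ≠ 0} := by
        refine ⟨b.map p.subtype ⊔ q, hgr ha, ?_, ⟨?_, ?_⟩, hfa⟩
        · intro j x hx
          obtain ⟨y, hy, z, hz, rfl⟩ := Submodule.mem_sup.1 hx
          change M.proj j (y + z) ∈ _
          rw [map_add]
          exact Submodule.add_mem_sup (hgr hb j y hy) (hq j z hz)
        · exact hdisj.disjoint_sup_right_of_disjoint_sup_left (by rw [hsup hab]; exact hpq.disjoint)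
        · rw [codisjoint_iff, ← sup_assoc, hsup hab, hpq.sup_eq_top]
      have hap : a.map p.subtype = p :=
        eq_of_le_of_not_lt (Submodule.map_subtype_le p a) (hmin _ hmem)
      have ha' : a = ⊤ := by
        exact Submodule.map_injective_of_injective p.subtype_injective
          (hap.trans (Submodule.map_subtype_top p).symm)
      rw [ha'] at hab
      exact eq_bot_of_top_isCompl hab
    by_cases hfa : f ∘ₗ (a.map p.subtype).subtype = 0
    · left
      refine main hb ha hab.symm fun hfb ↦ hpf (LinearMap.ext fun x ↦ ?_)
      have hle : p ≤ LinearMap.ker f := by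
        rw [← hsup hab]
        exact sup_le (fun y hy ↦ LinearMap.congr_fun hfa ⟨y, hy⟩)
          (fun y hy ↦ LinearMap.congr_fun hfb ⟨y, hy⟩)
      exact hle x.2
    · exact Or.inr (main ha hb hab hfa)

end GradedModuleOver

/-- **Indecomposable projective graded modules modulo shift ↔ indecomposable
projective ungraded modules.**  Let `A` be a `ℤ`-graded left-artinian ring.
Forgetting the grading induces a bijection between isomorphism classes of
finitely generated indecomposable projective `ℤ`-graded `A`-modules modulo shift
of grading and isomorphism classes of finitely generated indecomposable
projective ungraded `A`-modules. -/
theorem indecProjective_graded_modulo_shift_equiv_indecProjective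
    (A : Type u) [Ring A] [IsArtinian A A]
    (𝒜 : ℤ → AddSubgroup A) [GradedRing 𝒜] :
    ∃ F : Quot (fun M N : {M : GradedModuleOver A 𝒜 //
            Module.Finite A M.carrier ∧ IsGradedProjective M ∧
              IsGradedIndecomposable M} => ShiftIsoRel M.1 N.1) →
          Quot (fun L L' : {L : ModuleOver A //
            Module.Finite A L.carrier ∧ IsIndecProjective L} =>
            Nonempty (L.1.carrier ≃ₗ[A] L'.1.carrier)),
      Function.Bijective F ∧
      ∀ (M : GradedModuleOver A 𝒜)
        (hM : Module.Finite A M.carrier ∧ IsGradedProjective M ∧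
          IsGradedIndecomposable M)
        (L : ModuleOver A) (hL : Module.Finite A L.carrier ∧ IsIndecProjective L),
        Nonempty (M.carrier ≃ₗ[A] L.carrier) →
        F (Quot.mk _ ⟨M, hM⟩) = Quot.mk _ ⟨L, hL⟩ := by
  have forget : ∀ M : GradedModuleOver A 𝒜, Module.Finite A M.carrier ∧ IsGradedProjective M ∧
      IsGradedIndecomposable M → Module.Finite A M.carrier ∧
        IsIndecProjective (⟨M.carrier⟩ : ModuleOver A) := by
    rintro M ⟨hfin, hproj, hind⟩
    exact ⟨hfin, GradedModuleOver.projective_of_isGradedProjective hproj, hind.1,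
      GradedModuleOver.indecomposable_of_isGradedIndecomposable hind⟩
  refine ⟨Quot.map (fun M ↦ ⟨⟨M.1.carrier⟩, forget M.1 M.2⟩) ?_, ⟨?_, ?_⟩, ?_⟩
  · rintro M N ⟨i, e, -⟩
    exact ⟨e⟩
  · rintro ⟨M, hM⟩ ⟨N, hN⟩ h
    have hequiv : Equivalence (fun L L' : {L : ModuleOver A //
        Module.Finite A L.carrier ∧ IsIndecProjective L} =>
        Nonempty (L.1.carrier ≃ₗ[A] L'.1.carrier)) :=
      ⟨fun L ↦ ⟨LinearEquiv.refl A _⟩, fun ⟨e⟩ ↦ ⟨e.symm⟩, fun ⟨e⟩ ⟨e'⟩ ↦ ⟨e.trans e'⟩⟩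
    obtain ⟨e⟩ := hequiv.eqvGen_iff.1 (Quot.eqvGen_exact h)
    have := hM.1
    exact Quot.sound (GradedModuleOver.shiftIsoRel_of_linearEquiv hM.2.2 e)
  · rintro ⟨L, hfin, hproj, hnontriv, hind⟩
    obtain ⟨K, hK⟩ := IsCoatomic.exists_coatom (Submodule A L.carrier)
    have hsimple : IsSimpleModule A (L.carrier ⧸ K) := isSimpleModule_iff_isCoatom.2 hK
    have := IsSimpleModule.nontrivial A (L.carrier ⧸ K)
    obtain ⟨t, ht⟩ := exists_ne (0 : L.carrier ⧸ K)
    have hf : LinearMap.toSpanSingleton A (L.carrier ⧸ K) t ≠ 0 := fun h ↦ ht (by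
      simpa using LinearMap.congr_fun h 1)
    obtain ⟨p, q, hp, hq, hpq, hpf, hpind⟩ :=
      GradedModuleOver.exists_isGradedIndecomposable_summand
        (M := GradedModuleOver.regular 𝒜) hf
    let P := (GradedModuleOver.regular 𝒜).ofSubmodule p hp
    have hP : Module.Finite A P.carrier ∧ IsGradedProjective P ∧ IsGradedIndecomposable P :=
      ⟨inferInstanceAs (Module.Finite A p), GradedModuleOver.isGradedProjective_ofSubmodule
        GradedModuleOver.isGradedProjective_regular hp hq hpq, hpind⟩
    refine ⟨Quot.mk _ ⟨P, hP⟩, Quot.sound ?_⟩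
    obtain ⟨-, hPproj, -, hPind⟩ := forget P hP
    have : Module.Projective A p := hPproj
    exact nonempty_linearEquiv_of_common_simple_quotient (M := p) hPind hind _ K.mkQ
      (LinearMap.surjective_of_ne_zero hpf) K.mkQ_surjective
  · rintro M hM L hL ⟨e⟩
    exact Quot.sound ⟨e⟩
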